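/- arXiv:math/0702028 — 2 statements merged into one kernel-verified Lean document; each statement's English description precedes it below -/
import Mathlib

section
/- Let M be a nonzero uniformly finite R-module, N a submodule with N ≠ M, and N = N₁ ∩ ⋯ ∩ N_s a primary decomposition of N in M with As_R(M/N_i) = {X_i} for each i. Then As_R(M/N) ⊆ {X₁, ..., X_s}. -/
/-!
Definitions following Bavula, "Primary decompositions for left Noetherian rings".
All modules are left modules over an associative ring `R` with 1.
-/

universe u v

section Defs

variable (R : Type u) [Ring R]

/-- `N` is an essential submodule of the module `A`:
it intersects every nonzero submodule of `A` nontrivially. -/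
def EssentialSub {A : Type v} [AddCommGroup A] [Module R A] (N : Submodule R A) : Prop :=
  ∀ L : Submodule R A, L ≠ ⊥ → N ⊓ L ≠ ⊥

/-- A module `A` is uniform: it is nonzero and every nonzero submodule is essential. -/
def UniformMod (A : Type v) [AddCommGroup A] [Module R A] : Prop :=
  Nontrivial A ∧ ∀ V : Submodule R A, V ≠ ⊥ → EssentialSub R V

/-- A submodule is uniform if it is uniform as a module. -/
def UniformSub {A : Type v} [AddCommGroup A] [Module R A] (U : Submodule R A) : Prop :=
  UniformMod R ↥U

/-- `A` has finite uniform dimension: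
it contains no infinite direct sum of nonzero submodules. -/
def FinUdim (A : Type v) [AddCommGroup A] [Module R A] : Prop :=
  ¬ ∃ f : ℕ → Submodule R A, (∀ n, f n ≠ ⊥) ∧ iSupIndep f

/-- `A` has uniform dimension `n`: there is an essential direct sum of `n`
uniform submodules of `A`. -/
def UdimEq (A : Type v) [AddCommGroup A] [Module R A] (n : ℕ) : Prop :=
  ∃ U : Fin n → Submodule R A, (∀ i, UniformSub R (U i)) ∧
    iSupIndep U ∧ EssentialSub R (⨆ i, U i)

/-- Essential equivalence of modules: they possess isomorphic essential submodules. -/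
def EssEquiv (A B : ModuleCat.{v} R) : Prop :=
  ∃ (L₁ : Submodule R A) (L₂ : Submodule R B),
    EssentialSub R L₁ ∧ EssentialSub R L₂ ∧ Nonempty (L₁ ≃ₗ[R] L₂)

/-- The left spectrum-style quotient: classes `[A]` of modules under essential
equivalence (for uniform modules these classes are the left primes). -/
def LeftSpec := Quot (EssEquiv R)

/-- The class `[A]` of the module `A` under essential equivalence. -/
def leftPrime (A : Type v) [AddCommGroup A] [Module R A] : LeftSpec.{u, v} R :=
  Quot.mk _ (ModuleCat.of R A)

/-- The set `As_R(A)` of associated left primes of `A`: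
the classes of the uniform submodules of `A`. -/
def leftAss (A : Type v) [AddCommGroup A] [Module R A] : Set (LeftSpec.{u, v} R) :=
  { x | ∃ U : Submodule R A, UniformSub R U ∧ x = leftPrime R ↥U }

/-- `A` is uniformly finite: every factor module of `A` has finite uniform dimension. -/
def UniformlyFinite (A : Type v) [AddCommGroup A] [Module R A] : Prop :=
  ∀ N : Submodule R A, FinUdim R (A ⧸ N)

/-- `N` is an `X`-primary submodule of `A`: `A/N` has finite uniform dimension and
`As_R(A/N) = {X}`. -/
def PrimarySub {A : Type v} [AddCommGroup A] [Module R A] (N : Submodule R A)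
    (X : LeftSpec.{u, v} R) : Prop :=
  FinUdim R (A ⧸ N) ∧ leftAss R (A ⧸ N) = {X}

/-- `Ns` is a primary decomposition of `N` in `A`. -/
def IsPrimaryDecomp {A : Type v} [AddCommGroup A] [Module R A] (N : Submodule R A)
    (s : ℕ) (Ns : Fin s → Submodule R A) : Prop :=
  N = ⨅ i, Ns i ∧ ∀ i, ∃ X, PrimarySub R (Ns i) X

/-- `Ns` is a shortest primary decomposition of `N` in `A`:
no primary decomposition of `N` in `A` has fewer terms. -/
def IsShortestPrimaryDecomp {A : Type v} [AddCommGroup A] [Module R A] (N : Submodule R A)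
    (s : ℕ) (Ns : Fin s → Submodule R A) : Prop :=
  IsPrimaryDecomp R N s Ns ∧
    ∀ (t : ℕ) (Ls : Fin t → Submodule R A), IsPrimaryDecomp R N t Ls → s ≤ t

/-- `C` is a complement to `W` in the ambient module: `W ⊓ C = ⊥` and `C` is maximal
with this property. -/
def IsComplementTo {A : Type v} [AddCommGroup A] [Module R A] (C W : Submodule R A) : Prop :=
  W ⊓ C = ⊥ ∧ ∀ D : Submodule R A, C ≤ D → W ⊓ D = ⊥ → D = C

/-- A proper submodule `N ⊊ A` is irreducible if it is not the intersection of two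
strictly larger submodules. -/
def IrreducibleSub {A : Type v} [AddCommGroup A] [Module R A] (N : Submodule R A) : Prop :=
  N ≠ ⊤ ∧ ¬ ∃ P Q : Submodule R A, N < P ∧ N < Q ∧ N = P ⊓ Q

/-- The multiplicity of the left prime `x` in `A` is `m`: in some (equivalently, any)
essential direct sum of uniform submodules of `A`, exactly `m` summands lie in class `x`. -/
def HasMult (A : Type v) [AddCommGroup A] [Module R A] (x : LeftSpec.{u, v} R) (m : ℕ) : Prop :=
  ∃ (n : ℕ) (U : Fin n → Submodule R A), (∀ i, UniformSub R (U i)) ∧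
    iSupIndep U ∧ EssentialSub R (⨆ i, U i) ∧
    m = Nat.card {i : Fin n // leftPrime R ↥(U i) = x}

end Defs
/-- Finitely many nonzero submodules of a uniform module have nonzero intersection. -/
theorem UniformMod.iInf_fin_ne_bot {R : Type u} [Ring R] {A : Type v} [AddCommGroup A] [Module R A]
    (hA : UniformMod R A) {n : ℕ} (K : Fin n → Submodule R A) (hK : ∀ i, K i ≠ ⊥) :
    ⨅ i, K i ≠ ⊥ := by
  induction n with
  | zero =>
    have := hA.1
    rw [iInf_of_empty]
    exact top_ne_bot
  | succ n ih =>
    have hsucc : ⨅ i, K i = K 0 ⊓ ⨅ i : Fin n, K i.succ :=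
      le_antisymm (le_inf (iInf_le _ _) (le_iInf fun i => iInf_le _ _))
        (le_iInf (Fin.cases inf_le_left fun i => inf_le_right.trans (iInf_le _ i)))
    rw [hsucc]
    exact hA.2 _ (hK 0) _ (ih (fun i => K i.succ) fun i => hK i.succ)

/-- Uniformity is invariant under linear isomorphism. -/
theorem UniformMod.of_linearEquiv {R : Type u} [Ring R] {A B : Type v}
    [AddCommGroup A] [Module R A] [AddCommGroup B] [Module R B]
    (hA : UniformMod R A) (e : A ≃ₗ[R] B) : UniformMod R B := by
  have := hA.1
  have comap_ne_bot : ∀ V : Submodule R B, V ≠ ⊥ → V.comap (e : A →ₗ[R] B) ≠ ⊥ := by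
    intro V hV h
    obtain ⟨v, hv, hv0⟩ := V.ne_bot_iff.mp hV
    refine hv0 ?_
    have hmem : e.symm v ∈ V.comap (e : A →ₗ[R] B) := by simpa using hv
    rw [h, Submodule.mem_bot] at hmem
    simpa using hmem
  refine ⟨e.symm.toEquiv.nontrivial, fun V hV L hL h => ?_⟩
  refine hA.2 _ (comap_ne_bot V hV) _ (comap_ne_bot L hL) ?_
  rw [← Submodule.comap_inf, h]
  exact LinearMap.ker_eq_bot.mpr e.injective

/-- Isomorphic modules have the same class under essential equivalence. -/
theorem leftPrime_eq_of_linearEquiv {R : Type u} [Ring R] {A B : Type v}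
    [AddCommGroup A] [Module R A] [AddCommGroup B] [Module R B] (e : A ≃ₗ[R] B) :
    leftPrime R A = leftPrime R B := by
  refine Quot.sound ⟨⊤, ⊤, fun L hL => by rwa [top_inf_eq], fun L hL => by rwa [top_inf_eq], ⟨?_⟩⟩
  exact Submodule.topEquiv.trans (e.trans Submodule.topEquiv.symm)

/-- The class of a uniform module embedded in `B` is an associated left prime of `B`. -/
theorem leftPrime_mem_leftAss_of_injective {R : Type u} [Ring R] {A B : Type v}
    [AddCommGroup A] [Module R A] [AddCommGroup B] [Module R B]
    (hA : UniformMod R A) (g : A →ₗ[R] B) (hg : Function.Injective g) :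
    leftPrime R A ∈ leftAss R B :=
  ⟨g.range, hA.of_linearEquiv (LinearEquiv.ofInjective g hg),
    leftPrime_eq_of_linearEquiv (LinearEquiv.ofInjective g hg)⟩

/-- Theorem `RlufAss`(1): if `N = N₁ ∩ ⋯ ∩ N_s` is a primary
decomposition of a proper submodule `N` of a nonzero uniformly finite module `M`,
with `As_R(M/Nᵢ) = {Xᵢ}`, then `As_R(M/N) ⊆ {X₁, …, X_s}`. -/
theorem leftAss_subset_of_primaryDecomposition
    {R : Type u} [Ring R] {M : Type v} [AddCommGroup M] [Module R M]
    (hM : Nontrivial M) (huf : UniformlyFinite R M)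
    (N : Submodule R M) (hN : N ≠ ⊤)
    (s : ℕ) (Ns : Fin s → Submodule R M) (X : Fin s → LeftSpec.{u, v} R)
    (hdec : N = ⨅ i, Ns i) (hprim : ∀ i, PrimarySub R (Ns i) (X i)) :
    leftAss R (M ⧸ N) ⊆ Set.range X := by
  rintro _ ⟨U, hU, rfl⟩
  have hle : ∀ i, N ≤ Ns i := fun i => hdec ▸ iInf_le Ns i
  let g : ∀ i, U →ₗ[R] M ⧸ Ns i := fun i => (Submodule.factor (hle i)).comp U.subtype
  have hker : ⨅ i, (g i).ker = ⊥ := by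
    rw [eq_bot_iff]
    rintro ⟨x, hx⟩ hmem
    obtain ⟨m, rfl⟩ := N.mkQ_surjective x
    have hm : ∀ i, m ∈ Ns i := by
      intro i
      have hi := (Submodule.mem_iInf _).mp hmem i
      simpa [g] using hi
    have hmN : m ∈ N := hdec ▸ (Submodule.mem_iInf _).mpr hm
    rw [Submodule.mem_bot]
    exact Subtype.ext ((Submodule.Quotient.mk_eq_zero N).mpr hmN)
  obtain ⟨i, hi⟩ : ∃ i, (g i).ker = ⊥ := by
    by_contra! h
    exact UniformMod.iInf_fin_ne_bot hU _ h hker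
  have hmem := leftPrime_mem_leftAss_of_injective hU (g i) (LinearMap.ker_eq_bot.mp hi)
  rw [(hprim i).2, Set.mem_singleton_iff] at hmem
  exact ⟨i, hmem.symm⟩
end

section
/- Let M be a nonzero uniformly finite R-module, N a submodule with N ≠ M, and W₁, ..., W_s nonzero submodules of M/N such that the sum W₁ + ⋯ + W_s is direct and essential in M/N, and such that the sets As_R(W₁) = {X₁}, ..., As_R(W_s) = {X_s} are singletons with X₁, ..., X_s pairwise distinct. For each i, let C̄_i be a complement to W_i in M/N containing all W_j with j ≠ i, and let C_i = π⁻¹(C̄_i), where π : M → M/N is the canonical projection. Then: (1) the canonical image of W_i in M/C_i is an essential submodule of M/C_i, and hence C_i is an X_i-primary submodule of M; (2) N = C₁ ∩ ⋯ ∩ C_s is a maximal shortest primary decomposition of N in M. -/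
/-!
Definitions following Bavula, "Primary decompositions for left Noetherian rings".
All modules are left modules over an associative ring `R` with 1.
-/

universe u v

section Uniform

variable {R : Type u} [Ring R] {A B : Type v} [AddCommGroup A] [Module R A]
  [AddCommGroup B] [Module R B]

theorem EssentialSub.top : EssentialSub R (⊤ : Submodule R A) := fun L hL => by
  rwa [top_inf_eq]

theorem leftPrime_eq_of_equiv (e : A ≃ₗ[R] B) : leftPrime R A = leftPrime R B :=
  Quot.sound ⟨⊤, ⊤, EssentialSub.top, EssentialSub.top,
    ⟨Submodule.topEquiv.trans (e.trans Submodule.topEquiv.symm)⟩⟩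

theorem UniformMod.of_equiv (h : UniformMod R A) (e : A ≃ₗ[R] B) : UniformMod R B := by
  obtain ⟨hA, h⟩ := h
  refine ⟨e.symm.toEquiv.nontrivial, fun V hV L hL hVL => ?_⟩
  have key : ∀ S : Submodule R B, S.comap (e : A →ₗ[R] B) = ⊥ → S = ⊥ := fun S hS => by
    rw [← Submodule.map_comap_eq_of_surjective e.surjective S]
    exact (congrArg _ hS).trans (Submodule.map_bot _)
  refine h _ (fun h0 => hV (key V h0)) _ (fun h0 => hL (key L h0)) ?_
  rw [← Submodule.comap_inf, hVL]
  exact LinearMap.ker_eq_bot.2 e.injective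

theorem uniformSub_iff {U : Submodule R A} :
    UniformSub R U ↔ U ≠ ⊥ ∧
      ∀ V ≤ U, V ≠ ⊥ → ∀ L ≤ U, L ≠ ⊥ → V ⊓ L ≠ ⊥ := by
  have hinj := U.injective_subtype
  constructor
  · rintro ⟨hU, h⟩
    refine ⟨U.nontrivial_iff_ne_bot.1 hU, fun V hVU hV L hLU hL hVL => ?_⟩
    have key : ∀ S ≤ U, S ≠ ⊥ → S.comap U.subtype ≠ ⊥ := fun S hSU hS h0 => by
      apply hS
      rw [← inf_eq_right.2 hSU, ← Submodule.map_comap_subtype, h0, Submodule.map_bot]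
    apply h _ (key V hVU hV) _ (key L hLU hL)
    rw [← Submodule.comap_inf, hVL]
    exact U.ker_subtype
  · rintro ⟨hU, h⟩
    refine ⟨U.nontrivial_iff_ne_bot.2 hU, fun V hV L hL hVL => ?_⟩
    have key : ∀ S : Submodule R U, S ≠ ⊥ → S.map U.subtype ≠ ⊥ := fun S hS h0 =>
      hS (Submodule.map_injective_of_injective hinj (h0.trans (Submodule.map_bot _).symm))
    apply h _ (U.map_subtype_le V) (key V hV) _ (U.map_subtype_le L) (key L hL)
    rw [← Submodule.map_inf _ hinj, hVL, Submodule.map_bot]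

theorem UniformSub.mono {U V : Submodule R A} (hU : UniformSub R U) (hVU : V ≤ U) (hV : V ≠ ⊥) :
    UniformSub R V :=
  uniformSub_iff.2 ⟨hV, fun P hP hP0 L hL hL0 =>
    (uniformSub_iff.1 hU).2 P (hP.trans hVU) hP0 L (hL.trans hVU) hL0⟩

theorem UniformSub.leftPrime_eq {U V : Submodule R A} (hU : UniformSub R U) (hVU : V ≤ U)
    (hV : V ≠ ⊥) : leftPrime R V = leftPrime R U := by
  refine Quot.sound ⟨⊤, V.submoduleOf U, EssentialSub.top, hU.2 _ fun h0 => hV ?_,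
    ⟨Submodule.topEquiv.trans (Submodule.submoduleOfEquivOfLe hVU).symm⟩⟩
  have hdisj := Submodule.disjoint_iff_comap_eq_bot.2 h0
  rwa [disjoint_iff, inf_eq_right.2 hVU] at hdisj

theorem leftPrime_mem_leftAss (hA : UniformMod R A) (f : A →ₗ[R] B)
    (hf : Function.Injective f) : leftPrime R A ∈ leftAss R B :=
  ⟨LinearMap.range f, hA.of_equiv (LinearEquiv.ofInjective f hf),
    leftPrime_eq_of_equiv (LinearEquiv.ofInjective f hf)⟩

theorem leftAss_subset_of_injective (f : A →ₗ[R] B) (hf : Function.Injective f) :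
    leftAss R A ⊆ leftAss R B := by
  rintro _ ⟨U, hU, rfl⟩
  exact leftPrime_mem_leftAss hU (f ∘ₗ U.subtype) (hf.comp U.injective_subtype)

theorem leftAss_eq_of_equiv (e : A ≃ₗ[R] B) : leftAss R A = leftAss R B :=
  (leftAss_subset_of_injective (e : A →ₗ[R] B) e.injective).antisymm
    (leftAss_subset_of_injective (e.symm : B →ₗ[R] A) e.symm.injective)

theorem leftAss_eq_of_essential_range (f : A →ₗ[R] B) (hf : Function.Injective f)
    (hess : EssentialSub R (LinearMap.range f)) : leftAss R A = leftAss R B := by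
  refine (leftAss_subset_of_injective f hf).antisymm ?_
  rintro _ ⟨U, hU, rfl⟩
  have hV : LinearMap.range f ⊓ U ≠ ⊥ := hess U (uniformSub_iff.1 hU).1
  rw [← hU.leftPrime_eq inf_le_right hV]
  exact leftPrime_mem_leftAss (hU.mono inf_le_right hV)
    ((LinearEquiv.ofInjective f hf).symm.toLinearMap ∘ₗ Submodule.inclusion inf_le_left)
    ((LinearEquiv.ofInjective f hf).symm.injective.comp (Submodule.inclusion_injective _))

theorem UniformSub.exists_inf_eq_bot {U : Submodule R A} (hU : UniformSub R U) {ι : Type*}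
    [Finite ι] (D : ι → Submodule R A) (h : U ⊓ ⨅ i, D i = ⊥) : ∃ i, U ⊓ D i = ⊥ := by
  classical
  cases nonempty_fintype ι
  by_contra! hD
  obtain ⟨hU0, hU⟩ := uniformSub_iff.1 hU
  have key : ∀ S : Finset ι, U ⊓ S.inf D ≠ ⊥ := fun S => by
    induction S using Finset.induction_on with
    | empty => simpa using hU0
    | insert a S _ ih =>
      rw [Finset.inf_insert, inf_inf_distrib_left]
      exact hU _ inf_le_left (hD a) _ inf_le_left ih
  exact key Finset.univ (by rwa [Finset.inf_univ_eq_iInf])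

/-- Every associated left prime of `A ⧸ ⨅ i, L i` is one of some `A ⧸ L i`, for a finite
family `L`. -/
theorem leftAss_quotient_iInf_subset {ι : Type*} [Finite ι] {N : Submodule R A}
    (L : ι → Submodule R A) (hN : N = ⨅ i, L i) {x : LeftSpec.{u, v} R}
    (hx : x ∈ leftAss R (A ⧸ N)) : ∃ i, x ∈ leftAss R (A ⧸ L i) := by
  obtain ⟨U, hU, rfl⟩ := hx
  have hle : ∀ i, N ≤ L i := fun i => hN.le.trans (iInf_le _ i)
  have hker : ⨅ i, LinearMap.ker (Submodule.factor (hle i)) = ⊥ := by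
    refine (Submodule.eq_bot_iff _).2 fun y hy => ?_
    obtain ⟨m, rfl⟩ := N.mkQ_surjective y
    simp only [Submodule.mem_iInf, LinearMap.mem_ker] at hy
    rw [Submodule.mkQ_apply, Submodule.Quotient.mk_eq_zero, hN]
    exact (Submodule.mem_iInf _).2 fun i => (Submodule.Quotient.mk_eq_zero _).1 (hy i)
  obtain ⟨i, hi⟩ := hU.exists_inf_eq_bot _ (by rw [hker, inf_bot_eq])
  refine ⟨i, leftPrime_mem_leftAss hU ((Submodule.factor (hle i)).domRestrict U) ?_⟩
  exact LinearMap.injective_domRestrict_iff.2 (disjoint_iff.2 hi)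

theorem IsComplementTo.essentialSub_map_mkQ {C W : Submodule R A} (h : IsComplementTo R C W) :
    EssentialSub R (W.map C.mkQ) := by
  intro L hL hWL
  have hCL : C ≤ L.comap C.mkQ := C.le_comap_mkQ L
  refine hL ?_
  have hLC : L.comap C.mkQ = C := by
    refine h.2 _ hCL ((Submodule.eq_bot_iff _).2 fun x ⟨hxW, hxL⟩ => ?_)
    have hx : C.mkQ x ∈ W.map C.mkQ ⊓ L := ⟨Submodule.mem_map_of_mem hxW, hxL⟩
    rw [hWL, Submodule.mem_bot, Submodule.mkQ_apply, Submodule.Quotient.mk_eq_zero] at hx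
    exact (Submodule.eq_bot_iff _).1 h.1 x ⟨hxW, hx⟩
  rw [← Submodule.map_comap_eq_of_surjective C.mkQ_surjective L, hLC, Submodule.mkQ_map_self]

theorem IsComplementTo.leftAss_quotient {C W : Submodule R A} (h : IsComplementTo R C W) :
    leftAss R (A ⧸ C) = leftAss R W := by
  refine (leftAss_eq_of_essential_range (C.mkQ.domRestrict W) ?_ ?_).symm
  · rw [LinearMap.injective_domRestrict_iff, Submodule.ker_mkQ]
    exact disjoint_iff.2 h.1
  · rw [LinearMap.range_domRestrict]
    exact h.essentialSub_map_mkQ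

theorem iInf_complement_eq_bot {ι : Type*} [Fintype ι] {W C : ι → Submodule R A}
    (hess : EssentialSub R (⨆ i, W i)) (hle : ∀ i j, j ≠ i → W j ≤ C i)
    (hdisj : ∀ i, W i ⊓ C i = ⊥) : ⨅ i, C i = ⊥ := by
  classical
  by_contra h0
  refine hess _ h0 ((Submodule.eq_bot_iff _).2 fun x ⟨hxW, hxC⟩ => ?_)
  have hxW' : x ∈ ⨆ i ∈ Finset.univ, W i := by simpa using hxW
  obtain ⟨w, rfl⟩ := (Submodule.mem_iSup_finset_iff_exists_sum W x).1 hxW'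
  refine Finset.sum_eq_zero fun i _ => (Submodule.eq_bot_iff _).1 (hdisj i) _ ⟨(w i).2, ?_⟩
  have hi := (Submodule.mem_iInf _).1 hxC i
  rw [← Finset.add_sum_erase _ _ (Finset.mem_univ i)] at hi
  exact ((C i).add_mem_iff_left (Submodule.sum_mem _ fun j hj =>
    hle i j (Finset.ne_of_mem_erase hj) (w j).2)).1 hi

end Uniform

/-- Proposition `Csminprd`: let `N` be a proper submodule of a
nonzero uniformly finite module `M`, let `W₁ ⊕ ⋯ ⊕ W_s` be an essential direct sum of
nonzero submodules of `M/N` with `As_R(Wᵢ) = {Xᵢ}` pairwise distinct singletons; for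
each `i` let `C̄ᵢ` be a complement to `Wᵢ` in `M/N` containing the `Wⱼ` (`j ≠ i`) and
`Cᵢ = π⁻¹(C̄ᵢ)`. Then (1) the canonical image of `Wᵢ` in `M/Cᵢ ≅ (M/N)/C̄ᵢ` is
essential, so `Cᵢ` is `Xᵢ`-primary; (2) `N = C₁ ∩ ⋯ ∩ C_s` is a maximal shortest
primary decomposition of `N` in `M`. -/
theorem maximal_shortest_primaryDecomposition_construction
    {R : Type u} [Ring R] {M : Type v} [AddCommGroup M] [Module R M]
    (hM : Nontrivial M) (huf : UniformlyFinite R M)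
    (N : Submodule R M) (hN : N ≠ ⊤)
    (s : ℕ) (W : Fin s → Submodule R (M ⧸ N)) (X : Fin s → LeftSpec.{u, v} R)
    (hWne : ∀ i, W i ≠ ⊥)
    (hWind : iSupIndep W)
    (hWess : EssentialSub R (⨆ i, W i))
    (hWass : ∀ i, leftAss R ↥(W i) = {X i})
    (hXdist : Function.Injective X)
    (Cb : Fin s → Submodule R (M ⧸ N))
    (hCb : ∀ i, (∀ j, j ≠ i → W j ≤ Cb i) ∧ IsComplementTo R (Cb i) (W i))
    (C : Fin s → Submodule R M)
    (hC : ∀ i, C i = Submodule.comap N.mkQ (Cb i)) :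
    (∀ i, EssentialSub R (Submodule.map (Cb i).mkQ (W i)) ∧ PrimarySub R (C i) (X i)) ∧
    N = ⨅ i, C i ∧
    IsShortestPrimaryDecomp R N s C ∧
    (∀ C' : Fin s → Submodule R M, N = ⨅ i, C' i →
      (∀ i, PrimarySub R (C' i) (X i)) → (∀ i, C i ≤ C' i) → ∀ i, C i = C' i) := by
  have hcompl : ∀ i, IsComplementTo R (Cb i) (W i) := fun i => (hCb i).2
  have hprim : ∀ i, PrimarySub R (C i) (X i) := fun i => by
    have hker : C i = LinearMap.ker ((Cb i).mkQ ∘ₗ N.mkQ) := by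
      rw [hC i, LinearMap.ker_comp, Submodule.ker_mkQ]
    refine ⟨huf _, ?_⟩
    rw [← hWass i, ← (hcompl i).leftAss_quotient]
    exact leftAss_eq_of_equiv ((Submodule.quotEquivOfEq _ _ hker).trans
      (LinearMap.quotKerEquivOfSurjective _
        ((Cb i).mkQ_surjective.comp N.mkQ_surjective)))
  have hNC : N = ⨅ i, C i := by
    have hbot := iInf_complement_eq_bot hWess (fun i => (hCb i).1) fun i => (hcompl i).1
    simp_rw [hC, ← Submodule.comap_iInf]
    rw [hbot]
    exact N.ker_mkQ.symm
  refine ⟨fun i => ⟨(hcompl i).essentialSub_map_mkQ, hprim i⟩, hNC,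
    ⟨⟨hNC, fun i => ⟨X i, hprim i⟩⟩, fun t L hL => ?_⟩, fun C' hNC' _ hle i => ?_⟩
  · have hmem : ∀ i, X i ∈ leftAss R (M ⧸ N) := fun i =>
      leftAss_subset_of_injective (W i).subtype (W i).injective_subtype
        ((hWass i).ge (Set.mem_singleton _))
    choose σ hσ using fun i => leftAss_quotient_iInf_subset L hL.1 (hmem i)
    have hinj : Function.Injective σ := fun i j hij => by
      obtain ⟨Y, -, hY⟩ := hL.2 (σ i)
      have hi := hσ i
      have hj := hσ j
      rw [← hij] at hj
      rw [hY, Set.mem_singleton_iff] at hi hj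
      exact hXdist (hi.trans hj.symm)
    simpa using Fintype.card_le_of_injective σ hinj
  · have hNle : N ≤ C' i := hNC'.le.trans (iInf_le _ i)
    have hcomap : (Submodule.map N.mkQ (C' i)).comap N.mkQ = C' i := by
      rw [Submodule.comap_map_mkQ, sup_eq_right.2 hNle]
    rw [hC i, ← hcomap]
    congr 1
    refine ((hcompl i).2 _ ?_ ((Submodule.eq_bot_iff _).2 ?_)).symm
    · rw [← Submodule.map_comap_eq_of_surjective N.mkQ_surjective (Cb i), ← hC i]
      exact Submodule.map_mono (hle i)
    · rintro _ ⟨hyW, m, hm, rfl⟩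
      rw [Submodule.mkQ_apply, Submodule.Quotient.mk_eq_zero, hNC']
      refine (Submodule.mem_iInf _).2 fun j => ?_
      by_cases hij : i = j
      · exact hij ▸ hm
      · apply hle j
        rw [hC j]
        exact (hCb j).1 i hij hyW
end
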